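/- arXiv:2102.00760 — 7 statements merged into one kernel-verified Lean document; each statement's English description precedes it below -/
import Mathlib

section
/- Calibration inequality for surrogate mean estimation: let f* be a decoding of the surrogate target g* and, for any measurable g_n : X → H, let f_n be a decoding of g_n. Then the excess risk satisfies R(f_n) − R(f*) ≤ 2 c_ψ ∫_X ‖g_n(x) − g*(x)‖_H dρ_X(x). -/
open MeasureTheory ProbabilityTheory Real
open scoped RealInnerProductSpace ENNReal

noncomputable section

variable {X Y Z H : Type*}
variable [MeasurableSpace X] [MeasurableSpace Y]
variable [Fintype Z] [Nonempty Z] [MeasurableSpace Z] [MeasurableSingletonClass Z]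
variable [NormedAddCommGroup H] [InnerProductSpace ℝ H] [CompleteSpace H]
variable [SecondCountableTopology H] [MeasurableSpace H] [BorelSpace H]

/-- The risk of a predictor `f : X → Z` for the loss `ℓ(z, y) = ⟪ψ z, φ y⟫`. -/
def risk (ψ : Z → H) (φ : Y → H) (ρ : Measure (X × Y)) (f : X → Z) : ℝ :=
  ∫ p, ⟪ψ (f p.1), φ p.2⟫ ∂ρ

/-- The surrogate conditional mean `g*(x) = E_{Y ∼ ρ|ₓ}[φ(Y)]`, where `κ x = ρ|ₓ`. -/
def gStar (φ : Y → H) (κ : Kernel X Y) (x : X) : H :=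
  ∫ y, φ y ∂(κ x)

/-- `f` is a (measurable) decoding of `g : X → H`: pointwise, `f x` minimizes
`z ↦ ⟪ψ z, g x⟫` over `Z`. -/
def IsDecoding (ψ : Z → H) (g : X → H) (f : X → Z) : Prop :=
  Measurable f ∧ ∀ x z, ⟪ψ (f x), g x⟫ ≤ ⟪ψ z, g x⟫

lemma integrable_aux (ψ : Z → H) (φ : Y → H) (cψ : ℝ) (hψ : ∀ z, ‖ψ z‖ ≤ cψ) (hφ : Measurable φ)
    (μ : Measure X) [IsProbabilityMeasure μ] (κ : Kernel X Y) [IsMarkovKernel κ]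
    (hφ2 : Integrable (fun p : X × Y => ‖φ p.2‖ ^ 2) (μ ⊗ₘ κ)) (f : X → Z) (hf : Measurable f) :
    Integrable (fun x => ⟪ψ (f x), gStar φ κ x⟫) μ ∧
    risk ψ φ (μ ⊗ₘ κ) f = ∫ x, ⟪ψ (f x), gStar φ κ x⟫ ∂μ := by
  have hm : Measurable (fun p : X × Y => φ p.2) := hφ.comp measurable_snd
  have hI : Integrable (fun p : X × Y => φ p.2) (μ ⊗ₘ κ) :=
    ((memLp_two_iff_integrable_sq_norm hm.aestronglyMeasurable).2 hφ2).integrable (by norm_num)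
  have hψm : Measurable ψ := measurable_of_finite ψ
  have hJ : Integrable (fun p : X × Y => ⟪ψ (f p.1), φ p.2⟫) (μ ⊗ₘ κ) := by
    refine Integrable.mono' (hI.norm.const_mul cψ) ?_ ?_
    · exact ((hψm.comp (hf.comp measurable_fst)).inner hm).aestronglyMeasurable
    · refine Filter.Eventually.of_forall fun p => ?_
      exact (norm_inner_le_norm _ _).trans
        (mul_le_mul_of_nonneg_right (hψ _) (norm_nonneg _))
  have hae : ∀ᵐ x ∂μ, ∫ y, ⟪ψ (f x), φ y⟫ ∂(κ x) = ⟪ψ (f x), gStar φ κ x⟫ := by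
    have h1 := ((Measure.integrable_compProd_iff hm.aestronglyMeasurable).1 hI).1
    filter_upwards [h1] with x hx
    exact integral_inner hx _
  constructor
  · exact (Integrable.integral_compProd hJ).congr hae
  · unfold risk
    rw [Measure.integral_compProd hJ]
    exact integral_congr_ae hae

/-- **Calibration inequality** (Ciliberto et al.): the excess risk of a decoding `fn` of `gn`
is controlled by the `L¹` distance between `gn` and the surrogate target `g*`. -/
theorem calibration_inequality
    (ψ : Z → H) (φ : Y → H) (cψ : ℝ) (hψ : ∀ z, ‖ψ z‖ ≤ cψ) (hφ : Measurable φ)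
    (μ : Measure X) [IsProbabilityMeasure μ] (κ : Kernel X Y) [IsMarkovKernel κ]
    (hφ2 : Integrable (fun p : X × Y => ‖φ p.2‖ ^ 2) (μ ⊗ₘ κ))
    (gn : X → H) (hgn : Measurable gn)
    (fstar fn : X → Z)
    (hfstar : IsDecoding ψ (gStar φ κ) fstar)
    (hfn : IsDecoding ψ gn fn) :
    ENNReal.ofReal (risk ψ φ (μ ⊗ₘ κ) fn - risk ψ φ (μ ⊗ₘ κ) fstar)
      ≤ ENNReal.ofReal (2 * cψ) * ∫⁻ x, ‖gn x - gStar φ κ x‖₊ ∂μ := by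
  obtain ⟨i1, e1⟩ := integrable_aux ψ φ cψ hψ hφ μ κ hφ2 fn hfn.1
  obtain ⟨i2, e2⟩ := integrable_aux ψ φ cψ hψ hφ μ κ hφ2 fstar hfstar.1
  have hc : 0 ≤ cψ := (norm_nonneg _).trans (hψ (Classical.arbitrary Z))
  rw [e1, e2, ← integral_sub i1 i2, ← lintegral_const_mul' _ _ ENNReal.ofReal_ne_top]
  refine (ENNReal.ofReal_le_ofReal (le_abs_self _)).trans ?_
  rw [← Real.norm_eq_abs, ofReal_norm]
  refine (enorm_integral_le_lintegral_enorm _).trans (lintegral_mono fun x => ?_)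
  show _ ≤ ENNReal.ofReal (2 * cψ) * ‖gn x - gStar φ κ x‖ₑ
  rw [← ofReal_norm, ← ofReal_norm, ← ENNReal.ofReal_mul (by positivity)]
  refine ENNReal.ofReal_le_ofReal ?_
  have h0 := hfstar.2 x (fn x)
  have h1 := hfn.2 x (fstar x)
  rw [Real.norm_eq_abs, abs_of_nonneg (by linarith)]
  have a1 : |⟪ψ (fn x), gn x - gStar φ κ x⟫| ≤ cψ * ‖gn x - gStar φ κ x‖ :=
    (abs_real_inner_le_norm _ _).trans (mul_le_mul_of_nonneg_right (hψ _) (norm_nonneg _))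
  have a2 : |⟪ψ (fstar x), gn x - gStar φ κ x⟫| ≤ cψ * ‖gn x - gStar φ κ x‖ :=
    (abs_real_inner_le_norm _ _).trans (mul_le_mul_of_nonneg_right (hψ _) (norm_nonneg _))
  rw [inner_sub_right] at a1 a2
  have b1 := (abs_le.1 a1).1
  have b2 := (abs_le.1 a2).2
  linarith

end
end

section
/- Geometric refined decoding lemma: suppose Z is finite. Let ξ*, ξ_n ∈ H with ‖ξ_n − ξ*‖ < d(ξ*, F), where d(ξ*,F) = inf_{η∈F} ‖ξ* − η‖. Then the set argmin_{z∈Z} ⟨ψ(z), ξ*⟩ is a singleton {z*}, and every minimizer of z ↦ ⟨ψ(z), ξ_n⟩ equals z*. In particular, for x ∈ supp ρ_X, if ‖g_n(x) − g*(x)‖ < d(g*(x), F) then f_n(x) = f*(x) for any decodings f_n of g_n and f* of g*. -/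
open MeasureTheory Real
open scoped RealInnerProductSpace ENNReal

noncomputable section

variable {Z H : Type*}
variable [Fintype Z] [Nonempty Z]
variable [NormedAddCommGroup H] [InnerProductSpace ℝ H]

/-- The decision frontier `F`: points of `H` with at least two minimizers of
`z ↦ ⟪ψ z, ξ⟫`. -/
def decisionFrontier (ψ : Z → H) : Set H :=
  {ξ | ∃ z₁ z₂ : Z, z₁ ≠ z₂ ∧ (∀ z, ⟪ψ z₁, ξ⟫ ≤ ⟪ψ z, ξ⟫) ∧ ∀ z, ⟪ψ z₂, ξ⟫ ≤ ⟪ψ z, ξ⟫}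

/-- Distance (in `ℝ≥0∞`, so that the infimum over the empty set is `∞`) from a point to the
decision frontier. -/
def dF (ψ : Z → H) (ξ : H) : ℝ≥0∞ :=
  EMetric.infEdist ξ (decisionFrontier ψ)

theorem refined_decoding_aux (ψ : Z → H) (a b : H) (zs zn : Z)
    (h : edist b a < dF ψ a) (hs : ∀ z, ⟪ψ zs, a⟫ ≤ ⟪ψ z, a⟫)
    (hn : ∀ z, ⟪ψ zn, b⟫ ≤ ⟪ψ z, b⟫) : zn = zs := by
  by_contra hne
  have hcl : ∀ z : Z, IsClosed {ξ : H | ∀ z', ⟪ψ z, ξ⟫ ≤ ⟪ψ z', ξ⟫} := by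
    intro z
    simp only [Set.setOf_forall]
    exact isClosed_iInter fun z' => isClosed_le (by fun_prop) (by fun_prop)
  have hpre : IsPreconnected (segment ℝ a b) := (convex_segment a b).isPreconnected
  have hcl2 : IsClosed (⋃ z ∈ {z : Z | z ≠ zs}, {ξ : H | ∀ z', ⟪ψ z, ξ⟫ ≤ ⟪ψ z', ξ⟫}) :=
    Set.Finite.isClosed_biUnion (Set.toFinite _) fun z _ => hcl z
  obtain ⟨ξ, hξ, h1, h2⟩ := isPreconnected_closed_iff.1 hpre _ _ (hcl zs) hcl2
    (by
      intro ξ _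
      obtain ⟨z, hz⟩ := Finite.exists_min (fun z => ⟪ψ z, ξ⟫)
      by_cases hzz : z = zs
      · left; subst hzz; exact hz
      · right; exact Set.mem_biUnion (show z ∈ {z : Z | z ≠ zs} from hzz) hz)
    ⟨a, left_mem_segment ℝ a b, hs⟩
    ⟨b, right_mem_segment ℝ a b, Set.mem_biUnion (show zn ∈ {z : Z | z ≠ zs} from hne) hn⟩
  obtain ⟨z, hz, h3⟩ := Set.mem_iUnion₂.1 h2
  have hF : ξ ∈ decisionFrontier ψ := ⟨z, zs, hz, h3, h1⟩
  have hle : dF ψ a ≤ edist a ξ := Metric.infEDist_le_edist_of_mem hF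
  have hd : edist a ξ ≤ edist b a := by
    rw [edist_dist, edist_dist]
    apply ENNReal.ofReal_le_ofReal
    have := dist_add_dist_of_mem_segment hξ
    rw [dist_comm b a]
    linarith [dist_nonneg (x := ξ) (y := b)]
  exact absurd h (not_lt.2 (hle.trans hd))

/-- **Geometric refined decoding lemma**: if `ξn` is strictly closer to `ξ*` than `ξ*` is to the
decision frontier, then the argmin at `ξ*` is a singleton `{z*}` and every minimizer at `ξn`
equals `z*`.  In particular, pointwise, decodings of `gn` and `g*` agree wherever
`‖gn x − g* x‖ < d(g* x, F)`. -/
theorem refined_decoding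
    (ψ : Z → H) (ξstar ξn : H)
    (h : edist ξn ξstar < dF ψ ξstar) :
    (∃ zstar : Z, ({z : Z | ∀ z', ⟪ψ z, ξstar⟫ ≤ ⟪ψ z', ξstar⟫} = {zstar}) ∧
      ∀ z : Z, (∀ z', ⟪ψ z, ξn⟫ ≤ ⟪ψ z', ξn⟫) → z = zstar) ∧
    ∀ {X : Type} (gn g : X → H) (fn fstar : X → Z),
      (∀ x z, ⟪ψ (fn x), gn x⟫ ≤ ⟪ψ z, gn x⟫) →
      (∀ x z, ⟪ψ (fstar x), g x⟫ ≤ ⟪ψ z, g x⟫) →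
      ∀ x : X, edist (gn x) (g x) < dF ψ (g x) → fn x = fstar x := by
  refine ⟨?_, fun gn g fn fstar hfn hf x hx =>
    refined_decoding_aux ψ (g x) (gn x) _ _ hx (hf x) (hfn x)⟩
  obtain ⟨zs, hs⟩ := Finite.exists_min (fun z => ⟪ψ z, ξstar⟫)
  refine ⟨zs, ?_, fun z hz => refined_decoding_aux ψ ξstar ξn _ _ h hs hz⟩
  ext z
  constructor
  · intro hz
    refine refined_decoding_aux ψ ξstar ξstar _ _ ?_ hs hz
    rw [edist_self]
    exact lt_of_le_of_lt zero_le h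
  · rintro rfl
    exact hs

end
end

section
/- Refined calibration inequality: suppose Z is finite. Let f* be a decoding of g* and f_n a decoding of a measurable g_n : X → H. Then R(f_n) − R(f*) ≤ 2 c_ψ E_{X∼ρ_X}[ 1{‖g_n(X) − g*(X)‖ ≥ d(g*(X), F)} · ‖g_n(X) − g*(X)‖ ]. -/
open MeasureTheory ProbabilityTheory Real
open scoped RealInnerProductSpace ENNReal

noncomputable section

variable {X Y Z H : Type*}
variable [MeasurableSpace X] [MeasurableSpace Y]
variable [Fintype Z] [Nonempty Z] [MeasurableSpace Z] [MeasurableSingletonClass Z]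
variable [NormedAddCommGroup H] [InnerProductSpace ℝ H] [CompleteSpace H]
variable [SecondCountableTopology H] [MeasurableSpace H] [BorelSpace H]

theorem aux_frontier (ψ : Z → H) (a b : H) (z w : Z) (hz : ∀ v, ⟪ψ z, a⟫ ≤ ⟪ψ v, a⟫)
    (hw : ∀ v, ⟪ψ w, b⟫ ≤ ⟪ψ v, b⟫) (hzw : w ≠ z) :
    dF ψ a ≤ (‖b - a‖₊ : ℝ≥0∞) := by
  classical
  have hcl : ∀ u : Z, IsClosed {ξ : H | ∀ v, ⟪ψ u, ξ⟫ ≤ ⟪ψ v, ξ⟫} := by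
    intro u
    simp only [Set.setOf_forall]
    exact isClosed_iInter fun v => isClosed_le (by fun_prop) (by fun_prop)
  have hpre : IsPreconnected (segment ℝ a b) := (convex_segment a b).isPreconnected
  rw [isPreconnected_closed_iff] at hpre
  have hcl2 : IsClosed (⋃ u : {u : Z // u ≠ z}, {ξ : H | ∀ v, ⟪ψ u.1, ξ⟫ ≤ ⟪ψ v, ξ⟫}) :=
    isClosed_iUnion_of_finite fun u => hcl u.1
  obtain ⟨ξ, hξ, h1, h2⟩ := hpre _ _ (hcl z) hcl2
    (by
      intro ξ _
      obtain ⟨u, hu⟩ := Finite.exists_min (fun u : Z => ⟪ψ u, ξ⟫)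
      by_cases h : u = z
      · left; subst h; exact hu
      · right; exact Set.mem_iUnion.2 ⟨⟨u, h⟩, hu⟩)
    ⟨a, left_mem_segment ℝ a b, hz⟩
    ⟨b, right_mem_segment ℝ a b, Set.mem_iUnion.2 ⟨⟨w, hzw⟩, hw⟩⟩
  obtain ⟨⟨u, hu⟩, h2⟩ := Set.mem_iUnion.1 h2
  have hmem : ξ ∈ decisionFrontier ψ := ⟨u, z, hu, h2, h1⟩
  refine (Metric.infEDist_le_edist_of_mem hmem).trans ?_
  rw [segment_eq_image'] at hξ
  obtain ⟨t, ht, rfl⟩ := hξ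
  rw [edist_comm, edist_eq_enorm_sub, add_sub_cancel_left, enorm_eq_nnnorm]
  norm_cast
  rw [← NNReal.coe_le_coe, coe_nnnorm, coe_nnnorm, norm_smul, Real.norm_of_nonneg ht.1]
  exact mul_le_of_le_one_left (norm_nonneg _) ht.2

theorem aux_pointwise (ψ : Z → H) (c : ℝ) (hψ : ∀ z, ‖ψ z‖ ≤ c) (a b : H) (z w : Z)
    (hw : ∀ v, ⟪ψ w, b⟫ ≤ ⟪ψ v, b⟫) :
    ⟪ψ w - ψ z, a⟫ ≤ 2 * c * ‖b - a‖ := by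
  have h1 : ⟪ψ w - ψ z, a⟫ ≤ ⟪ψ w - ψ z, a - b⟫ := by
    have := hw z
    simp only [inner_sub_left, inner_sub_right]
    linarith
  have h2 : ‖ψ w - ψ z‖ ≤ 2 * c := (norm_sub_le _ _).trans (by linarith [hψ w, hψ z])
  refine h1.trans ((real_inner_le_norm _ _).trans ?_)
  rw [norm_sub_rev b a]
  exact mul_le_mul_of_nonneg_right h2 (norm_nonneg _)

/-- **Refined calibration inequality**: the excess risk is controlled by the `L¹`-norm of
`gn − g*` restricted to the event where `gn` deviates from `g*` by at least the distance of
`g*` to the decision frontier. -/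
theorem refined_calibration
    (ψ : Z → H) (φ : Y → H) (cψ : ℝ) (hψ : ∀ z, ‖ψ z‖ ≤ cψ) (hφ : Measurable φ)
    (μ : Measure X) [IsProbabilityMeasure μ] (κ : Kernel X Y) [IsMarkovKernel κ]
    (hφ2 : Integrable (fun p : X × Y => ‖φ p.2‖ ^ 2) (μ ⊗ₘ κ))
    (gn : X → H) (hgn : Measurable gn)
    (fstar fn : X → Z)
    (hfstar : IsDecoding ψ (gStar φ κ) fstar)
    (hfn : IsDecoding ψ gn fn) :
    ENNReal.ofReal (risk ψ φ (μ ⊗ₘ κ) fn - risk ψ φ (μ ⊗ₘ κ) fstar)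
      ≤ ENNReal.ofReal (2 * cψ) *
        ∫⁻ x in {x | dF ψ (gStar φ κ x) ≤ (‖gn x - gStar φ κ x‖₊ : ℝ≥0∞)},
          (‖gn x - gStar φ κ x‖₊ : ℝ≥0∞) ∂μ := by
  have hc : 0 ≤ cψ := (norm_nonneg _).trans (hψ (Classical.arbitrary Z))
  have hg : Measurable (gStar φ κ) :=
    (hφ.stronglyMeasurable.integral_kernel (κ := κ)).measurable
  have hφ1 : Integrable (fun p : X × Y => φ p.2) (μ ⊗ₘ κ) := by
    have hm : AEStronglyMeasurable (fun p : X × Y => φ p.2) (μ ⊗ₘ κ) :=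
      (hφ.comp measurable_snd).stronglyMeasurable.aestronglyMeasurable
    exact ((memLp_two_iff_integrable_sq_norm hm).2 hφ2).integrable (by norm_num)
  have hint : ∀ f : X → Z, Measurable f →
      Integrable (fun p : X × Y => ⟪ψ (f p.1), φ p.2⟫) (μ ⊗ₘ κ) := by
    intro f hf
    have hmf : Measurable (fun p : X × Y => ψ (f p.1)) :=
      (measurable_of_finite ψ).comp (hf.comp measurable_fst)
    refine Integrable.mono' (hφ1.norm.const_mul cψ)
      (hmf.inner (hφ.comp measurable_snd)).stronglyMeasurable.aestronglyMeasurable ?_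
    refine Filter.Eventually.of_forall fun p => ?_
    exact (norm_inner_le_norm _ _).trans (mul_le_mul_of_nonneg_right (hψ _) (norm_nonneg _))
  have hrisk : risk ψ φ (μ ⊗ₘ κ) fn - risk ψ φ (μ ⊗ₘ κ) fstar
      = ∫ x, ⟪ψ (fn x) - ψ (fstar x), gStar φ κ x⟫ ∂μ := by
    unfold risk
    have hi : Integrable (fun p : X × Y => ⟪ψ (fn p.1), φ p.2⟫ - ⟪ψ (fstar p.1), φ p.2⟫)
        (μ ⊗ₘ κ) := (hint fn hfn.1).sub (hint fstar hfstar.1)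
    rw [← integral_sub (hint fn hfn.1) (hint fstar hfstar.1), Measure.integral_compProd hi]
    refine integral_congr_ae ?_
    filter_upwards [hφ1.ae_of_compProd] with x hx
    simp only [← inner_sub_left]
    exact integral_inner hx _
  have hS : MeasurableSet {x | dF ψ (gStar φ κ x) ≤ (‖gn x - gStar φ κ x‖₊ : ℝ≥0∞)} := by
    refine measurableSet_le ?_ ?_
    · exact measurable_infEDist.comp hg
    · exact (hgn.sub hg).nnnorm.coe_nnreal_ennreal
  rw [hrisk, ← lintegral_indicator hS, ← lintegral_const_mul' _ _ ENNReal.ofReal_ne_top]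
  refine ((Real.ofReal_le_enorm _).trans (enorm_integral_le_lintegral_enorm _)).trans
    (lintegral_mono fun x => ?_)
  have hnn : 0 ≤ ⟪ψ (fn x) - ψ (fstar x), gStar φ κ x⟫ := by
    rw [inner_sub_left]
    linarith [hfstar.2 x (fn x)]
  simp only [Real.enorm_eq_ofReal hnn]
  by_cases hx : dF ψ (gStar φ κ x) ≤ (‖gn x - gStar φ κ x‖₊ : ℝ≥0∞)
  · rw [Set.indicator_of_mem (by exact hx), ← enorm_eq_nnnorm, ← ofReal_norm,
      ← ENNReal.ofReal_mul (by positivity)]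
    exact ENNReal.ofReal_le_ofReal (aux_pointwise ψ cψ hψ _ _ _ _ (hfn.2 x))
  · have : fn x = fstar x := by
      by_contra hne
      exact hx (aux_frontier ψ _ _ _ _ (hfstar.2 x) (hfn.2 x) hne)
    simp [this]

end
end

section
/- Rates under no-density separation: assume ℓ(z,y) ≤ ℓ_∞ for all (z,y), Z finite, and the no-density separation: there is t₀ > 0 with P_{X∼ρ_X}(d(g*(X), F) < t₀) = 0. Let (Ω,P) be a probability space and g_n : Ω × X → H jointly measurable such that for some L, M > 0 and every t > 0, sup_{x∈supp ρ_X} P(‖g_n(ω,x) − g*(x)‖ > t) ≤ exp(−L t² / (1 + M t)). Let f_n(ω) be a decoding of g_n(ω,·) and f* a decoding of g*. Then E_ω[R(f_n(ω))] − R(f*) ≤ ℓ_∞ · exp(−L t₀² / (1 + M t₀)). -/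
open MeasureTheory ProbabilityTheory Real
open scoped RealInnerProductSpace ENNReal

noncomputable section

variable {X Y Z H Ω : Type*}
variable [TopologicalSpace X] [PolishSpace X] [MeasurableSpace X] [BorelSpace X]
variable [MeasurableSpace Y] [MeasurableSpace Ω]
variable [Fintype Z] [Nonempty Z] [MeasurableSpace Z] [MeasurableSingletonClass Z]
variable [NormedAddCommGroup H] [InnerProductSpace ℝ H] [CompleteSpace H]
variable [SecondCountableTopology H] [MeasurableSpace H] [BorelSpace H]

/-- The (topological) support of a measure: points all of whose neighborhoods have
positive mass. -/
def msupp (μ : Measure X) : Set X :=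
  {x | ∀ U : Set X, IsOpen U → x ∈ U → 0 < μ U}

lemma frontier_dist (ψ : Z → H) (a b : H) (z₁ z₂ : Z) (hne : z₂ ≠ z₁)
    (h1 : ∀ z, ⟪ψ z₁, a⟫ ≤ ⟪ψ z, a⟫) (h2 : ∀ z, ⟪ψ z₂, b⟫ ≤ ⟪ψ z, b⟫) :
    dF ψ a ≤ ENNReal.ofReal ‖b - a‖ := by
  have hcl : ∀ z : Z, IsClosed {ξ : H | ∀ w, ⟪ψ z, ξ⟫ ≤ ⟪ψ w, ξ⟫} := by
    intro z
    simp only [Set.setOf_forall]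
    exact isClosed_iInter fun w => isClosed_le (by fun_prop) (by fun_prop)
  have hcl2 : IsClosed (⋃ z ∈ {z : Z | z ≠ z₁}, {ξ : H | ∀ w, ⟪ψ z, ξ⟫ ≤ ⟪ψ w, ξ⟫}) :=
    (Set.toFinite _).isClosed_biUnion fun z _ => hcl z
  have hpre : IsPreconnected (segment ℝ a b) := (convex_segment a b).isPreconnected
  rw [isPreconnected_closed_iff] at hpre
  obtain ⟨ξ, hξ, hξ1, hξ2⟩ := hpre _ _ (hcl z₁) hcl2 (by
    intro ξ _
    obtain ⟨z, hz⟩ := Finite.exists_min (fun z : Z => ⟪ψ z, ξ⟫)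
    by_cases hzz : z = z₁
    · left; subst hzz; exact hz
    · right; exact Set.mem_biUnion (x := z) hzz hz)
    ⟨a, left_mem_segment ℝ a b, h1⟩
    ⟨b, right_mem_segment ℝ a b, Set.mem_biUnion (x := z₂) hne h2⟩
  obtain ⟨z, hz, hzξ⟩ := Set.mem_iUnion₂.1 hξ2
  have hF : ξ ∈ decisionFrontier ψ := ⟨z₁, z, fun h => hz h.symm, hξ1, hzξ⟩
  refine (Metric.infEDist_le_edist_of_mem hF).trans ?_
  rw [edist_dist]
  apply ENNReal.ofReal_le_ofReal
  obtain ⟨s, hs, rfl⟩ := (segment_eq_image' ℝ a b) ▸ hξ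
  simp only [dist_self_add_right, norm_smul, Real.norm_eq_abs, abs_of_nonneg hs.1]
  exact mul_le_of_le_one_left (norm_nonneg _) hs.2

lemma ae_mem_msupp (μ : Measure X) : ∀ᵐ x ∂μ, x ∈ msupp μ := by
  rw [ae_iff]
  refine measure_null_of_locally_null _ fun x hx => ?_
  simp only [msupp, Set.mem_setOf_eq, not_forall, not_lt, nonpos_iff_eq_zero] at hx
  obtain ⟨U, hU, hxU, h0⟩ := hx
  exact ⟨U, mem_nhdsWithin_of_mem_nhds (hU.mem_nhds hxU), h0⟩

lemma conc_le (P : Measure Ω) (h : Ω → ℝ) (L M t₀ : ℝ) (ht₀ : 0 < t₀) (hM : 0 < M)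
    (hc : ∀ t : ℝ, 0 < t →
      P {ω | t < h ω} ≤ ENNReal.ofReal (exp (-(L * t ^ 2) / (1 + M * t)))) :
    P {ω | t₀ ≤ h ω} ≤ ENNReal.ofReal (exp (-(L * t₀ ^ 2) / (1 + M * t₀))) := by
  have hcont : ContinuousAt
      (fun t : ℝ => ENNReal.ofReal (exp (-(L * t ^ 2) / (1 + M * t)))) t₀ := by
    apply ENNReal.continuous_ofReal.continuousAt.comp
    apply Real.continuous_exp.continuousAt.comp
    apply ContinuousAt.div (by fun_prop) (by fun_prop)
    positivity
  refine ge_of_tendsto (hcont.tendsto.mono_left (nhdsWithin_le_nhds (s := Set.Iio t₀))) ?_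
  filter_upwards [Ioo_mem_nhdsLT ht₀] with t ht
  exact (measure_mono fun ω hω => lt_of_lt_of_le ht.2 hω).trans (hc t ht.1)

lemma loss_integrable (ψ : Z → H) (φ : Y → H) (hφ : Measurable φ) (ρ : Measure (X × Y))
    [IsFiniteMeasure ρ] (ℓinf : ℝ) (hℓnn : ∀ z y, 0 ≤ ⟪ψ z, φ y⟫)
    (hℓinf : ∀ z y, ⟪ψ z, φ y⟫ ≤ ℓinf) (f : X → Z) (hf : Measurable f) :
    Integrable (fun p : X × Y => ⟪ψ (f p.1), φ p.2⟫) ρ := by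
  have hψm : Measurable ψ := measurable_of_finite ψ
  refine Integrable.of_bound (C := ℓinf) (Measurable.aestronglyMeasurable ?_) ?_
  · exact (hψm.comp (hf.comp measurable_fst)).inner (hφ.comp measurable_snd)
  · exact Filter.Eventually.of_forall fun p => by
      rw [Real.norm_eq_abs, abs_of_nonneg (hℓnn _ _)]; exact hℓinf _ _

/-- **Rates under no-density separation**: with a bounded loss, under the hard margin
(no-density) condition and a Bernstein-type pointwise exponential concentration of the
surrogate estimates, the expected excess risk decreases exponentially. -/
theorem rates_no_density_separation
    (ψ : Z → H) (φ : Y → H) (cψ : ℝ) (hψ : ∀ z, ‖ψ z‖ ≤ cψ) (hφ : Measurable φ)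
    (μ : Measure X) [IsProbabilityMeasure μ] (κ : Kernel X Y) [IsMarkovKernel κ]
    (hφ2 : Integrable (fun p : X × Y => ‖φ p.2‖ ^ 2) (μ ⊗ₘ κ))
    (ℓinf : ℝ) (hℓnn : ∀ z y, 0 ≤ ⟪ψ z, φ y⟫) (hℓinf : ∀ z y, ⟪ψ z, φ y⟫ ≤ ℓinf)
    (t₀ : ℝ) (ht₀ : 0 < t₀)
    (hnodensity : μ {x | dF ψ (gStar φ κ x) < ENNReal.ofReal t₀} = 0)
    (P : Measure Ω) [IsProbabilityMeasure P]
    (gn : Ω → X → H) (hgn : Measurable (Function.uncurry gn))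
    (L M : ℝ) (hL : 0 < L) (hM : 0 < M)
    (hconc : ∀ t : ℝ, 0 < t → ∀ x ∈ msupp μ,
      P {ω | t < ‖gn ω x - gStar φ κ x‖} ≤ ENNReal.ofReal (exp (-(L * t ^ 2) / (1 + M * t))))
    (fn : Ω → X → Z) (hfn : ∀ ω, IsDecoding ψ (gn ω) (fn ω))
    (hfnm : Measurable (Function.uncurry fn))
    (fstar : X → Z) (hfstar : IsDecoding ψ (gStar φ κ) fstar) :
    (∫ ω, risk ψ φ (μ ⊗ₘ κ) (fn ω) ∂P) - risk ψ φ (μ ⊗ₘ κ) fstar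
      ≤ ℓinf * exp (-(L * t₀ ^ 2) / (1 + M * t₀)) := by
  have hX : Nonempty X := μ.nonempty_of_neZero
  obtain ⟨x₀⟩ := hX
  obtain ⟨y₀⟩ : Nonempty Y := (κ x₀).nonempty_of_neZero
  have hℓ0 : 0 ≤ ℓinf := (hℓnn (fstar x₀) y₀).trans (hℓinf _ _)
  set e := exp (-(L * t₀ ^ 2) / (1 + M * t₀)) with he
  let S : Set (Ω × X) := {p | fn p.1 p.2 ≠ fstar p.2}
  have hS : MeasurableSet S :=
    (measurableSet_eq_fun hfnm (hfstar.1.comp measurable_snd)).compl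
  have hSω : ∀ ω, MeasurableSet (Prod.mk ω ⁻¹' S) := fun ω => measurable_prodMk_left hS
  have hSmeas : Measurable fun ω => μ (Prod.mk ω ⁻¹' S) := measurable_measure_prodMk_left hS
  -- pointwise bound
  have hpt : ∀ ω, risk ψ φ (μ ⊗ₘ κ) (fn ω)
      ≤ risk ψ φ (μ ⊗ₘ κ) fstar + ℓinf * μ.real (Prod.mk ω ⁻¹' S) := by
    intro ω
    have hI2 := loss_integrable ψ φ hφ (μ ⊗ₘ κ) ℓinf hℓnn hℓinf fstar hfstar.1
    have hI1 := loss_integrable ψ φ hφ (μ ⊗ₘ κ) ℓinf hℓnn hℓinf (fn ω) (hfn ω).1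
    have hT : MeasurableSet (Prod.fst ⁻¹' (Prod.mk ω ⁻¹' S) : Set (X × Y)) :=
      measurable_fst (hSω ω)
    have hI3 : Integrable ((Prod.fst ⁻¹' (Prod.mk ω ⁻¹' S) : Set (X × Y)).indicator
        (fun _ => ℓinf)) (μ ⊗ₘ κ) := (integrable_const ℓinf).indicator hT
    have hm : (μ ⊗ₘ κ).real (Prod.fst ⁻¹' (Prod.mk ω ⁻¹' S)) = μ.real (Prod.mk ω ⁻¹' S) := by
      rw [measureReal_def, measureReal_def, ← Measure.map_apply measurable_fst (hSω ω)]
      have := Measure.fst_compProd μ κ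
      rw [Measure.fst] at this
      rw [this]
    have h3 : ∫ p, (Prod.fst ⁻¹' (Prod.mk ω ⁻¹' S) : Set (X × Y)).indicator
        (fun _ => ℓinf) p ∂(μ ⊗ₘ κ) = ℓinf * μ.real (Prod.mk ω ⁻¹' S) := by
      rw [integral_indicator_const _ hT, hm, smul_eq_mul, mul_comm]
    unfold risk
    rw [← h3, ← integral_add hI2 hI3]
    refine integral_mono hI1 (hI2.add hI3) fun p => ?_
    by_cases hp : fn ω p.1 = fstar p.1
    · have : p ∉ (Prod.fst ⁻¹' (Prod.mk ω ⁻¹' S) : Set (X × Y)) := fun h => h hp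
      simp only [Pi.add_apply, Set.indicator_of_notMem this, hp, add_zero, le_refl]
    · have : p ∈ (Prod.fst ⁻¹' (Prod.mk ω ⁻¹' S) : Set (X × Y)) := hp
      simp only [Pi.add_apply, Set.indicator_of_mem this]
      linarith [hℓnn (fstar p.1) p.2, hℓinf (fn ω p.1) p.2]
  -- probability bound
  have hprob : ∫⁻ ω, μ (Prod.mk ω ⁻¹' S) ∂P ≤ ENNReal.ofReal e := by
    rw [← Measure.prod_apply hS, Measure.prod_apply_symm hS]
    have hnd : ∀ᵐ x ∂μ, ¬ dF ψ (gStar φ κ x) < ENNReal.ofReal t₀ := by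
      rw [ae_iff]; simpa using hnodensity
    calc ∫⁻ x, P ((fun ω => (ω, x)) ⁻¹' S) ∂μ ≤ ∫⁻ _, ENNReal.ofReal e ∂μ := by
          apply lintegral_mono_ae
          filter_upwards [ae_mem_msupp μ, hnd] with x hx hd
          refine (measure_mono ?_).trans (conc_le P (fun ω => ‖gn ω x - gStar φ κ x‖) L M t₀ ht₀ hM
            fun t ht => hconc t ht x hx)
          intro ω hω
          have := frontier_dist ψ (gStar φ κ x) (gn ω x) (fstar x) (fn ω x) hω
            (hfstar.2 x) ((hfn ω).2 x)
          exact (ENNReal.ofReal_le_ofReal_iff (norm_nonneg _)).1 ((not_lt.1 hd).trans this)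
      _ = ENNReal.ofReal e := by simp
  have hint : Integrable (fun ω => μ.real (Prod.mk ω ⁻¹' S)) P :=
    Integrable.of_bound (C := 1) hSmeas.ennreal_toReal.aestronglyMeasurable
      (Filter.Eventually.of_forall fun ω => by
        rw [Real.norm_eq_abs, abs_of_nonneg measureReal_nonneg]; exact measureReal_le_one)
  have hreal : ∫ ω, μ.real (Prod.mk ω ⁻¹' S) ∂P ≤ e := by
    simp only [measureReal_def]
    rw [integral_toReal hSmeas.aemeasurable
      (Filter.Eventually.of_forall fun ω => measure_lt_top _ _)]
    exact ENNReal.toReal_le_of_le_ofReal (exp_pos _).le hprob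
  have hmain : ∫ ω, risk ψ φ (μ ⊗ₘ κ) (fn ω) ∂P
      ≤ ∫ ω, (risk ψ φ (μ ⊗ₘ κ) fstar + ℓinf * μ.real (Prod.mk ω ⁻¹' S)) ∂P :=
    integral_mono_of_nonneg
      (Filter.Eventually.of_forall fun ω => integral_nonneg fun p => hℓnn _ _)
      ((integrable_const _).add (hint.const_mul _)) (Filter.Eventually.of_forall hpt)
  rw [integral_add (integrable_const _) (hint.const_mul _), integral_const_mul] at hmain
  simp only [integral_const, probReal_univ, one_smul] at hmain
  nlinarith [mul_le_mul_of_nonneg_left hreal hℓ0]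

end
end

section
/- Equivalence of margin quantities: let Z be finite, ψ : Z → H injective with ‖ψ(z)‖ ≤ c_ψ, and set m = min_{z ≠ z'} ‖ψ(z) − ψ(z')‖ > 0. Let ξ ∈ H \ F, let z* be the unique minimizer of z ↦ ⟨ψ(z), ξ⟩, and define γ(ξ) = inf_{z ≠ z*} ⟨ψ(z) − ψ(z*), ξ⟩. Then (1/(2 c_ψ)) γ(ξ) ≤ d(ξ, F) ≤ (1/m) γ(ξ). -/
open MeasureTheory Real
open scoped RealInnerProductSpace ENNReal

noncomputable section

variable {Z H : Type*}
variable [Fintype Z] [Nonempty Z]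
variable [NormedAddCommGroup H] [InnerProductSpace ℝ H]

/-- **Equivalence of margin quantities**: for `ξ` outside the decision frontier, with unique
minimizer `z*`, the margin `γ(ξ) = inf_{z ≠ z*} ⟪ψ z − ψ z*, ξ⟫` and the distance of `ξ` to
the decision frontier satisfy `γ(ξ)/(2 cψ) ≤ d(ξ, F) ≤ γ(ξ)/m`, where
`m = min_{z ≠ z'} ‖ψ z − ψ z'‖ > 0`. -/
theorem margin_equivalence
    (ψ : Z → H) (hinj : Function.Injective ψ)
    (cψ : ℝ) (hψ : ∀ z, ‖ψ z‖ ≤ cψ)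
    (m : ℝ) (hm : 0 < m)
    (hmdef : IsLeast {r : ℝ | ∃ z z' : Z, z ≠ z' ∧ r = ‖ψ z - ψ z'‖} m)
    (ξ : H) (hξ : ξ ∉ decisionFrontier ψ)
    (zstar : Z) (hzstar : ∀ z, ⟪ψ zstar, ξ⟫ ≤ ⟪ψ z, ξ⟫)
    (γ : ℝ) (hγ : IsLeast {r : ℝ | ∃ z : Z, z ≠ zstar ∧ r = ⟪ψ z - ψ zstar, ξ⟫} γ) :
    ENNReal.ofReal (γ / (2 * cψ)) ≤ dF ψ ξ ∧ dF ψ ξ ≤ ENNReal.ofReal (γ / m) := by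
  obtain ⟨⟨z0, hz0, hγ0⟩, hγle⟩ := hγ
  have hγle' : ∀ z, z ≠ zstar → γ ≤ ⟪ψ z - ψ zstar, ξ⟫ := fun z hz => hγle ⟨z, hz, rfl⟩
  have hγnn : 0 ≤ γ := by
    rw [hγ0, inner_sub_left]; linarith [hzstar z0]
  have hmle : m ≤ ‖ψ z0 - ψ zstar‖ := hmdef.2 ⟨z0, zstar, hz0, rfl⟩
  have hc : 0 < cψ := by
    have h1 := norm_sub_le (ψ z0) (ψ zstar)
    linarith [hψ z0, hψ zstar]
  constructor
  · unfold dF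
    refine Metric.le_infEDist.2 ?_
    rintro η ⟨z₁, z₂, hne, h1, h2⟩
    have key : ∃ z, z ≠ zstar ∧ ∀ z', ⟪ψ z, η⟫ ≤ ⟪ψ z', η⟫ := by
      by_cases h : z₁ = zstar
      · exact ⟨z₂, fun h' => hne (h.trans h'.symm), h2⟩
      · exact ⟨z₁, h, h1⟩
    obtain ⟨z, hz, hmin⟩ := key
    rw [edist_dist, dist_eq_norm]
    apply ENNReal.ofReal_le_ofReal
    rw [div_le_iff₀ (by positivity)]
    have e1 := hγle' z hz
    have e2 : ⟪ψ z - ψ zstar, η⟫ ≤ 0 := by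
      rw [inner_sub_left]; linarith [hmin zstar]
    have e3 : ⟪ψ z - ψ zstar, ξ - η⟫ ≤ ‖ψ z - ψ zstar‖ * ‖ξ - η‖ := real_inner_le_norm _ _
    rw [inner_sub_right] at e3
    have e4 : ‖ψ z - ψ zstar‖ ≤ 2 * cψ := by
      have h1 := norm_sub_le (ψ z) (ψ zstar)
      linarith [hψ z, hψ zstar]
    have e5 := mul_le_mul_of_nonneg_right e4 (norm_nonneg (ξ - η))
    linarith
  · classical
    set u := ψ z0 - ψ zstar with hu
    have hupos : 0 < ‖u‖ := lt_of_lt_of_le hm hmle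
    have hmem : ∀ z, z ∈ Finset.univ.erase zstar ↔ z ≠ zstar := by simp
    have hne : (Finset.univ.erase zstar).Nonempty := ⟨z0, (hmem z0).2 hz0⟩
    let f : ℝ → ℝ := fun t =>
      (Finset.univ.erase zstar).inf' hne (fun z => ⟪ψ z - ψ zstar, ξ - t • u⟫)
    have hf : Continuous f := by
      apply Continuous.finset_inf'_apply
      intro z _
      fun_prop
    have hT : 0 ≤ γ / ‖u‖ ^ 2 := by positivity
    have hf0 : 0 ≤ f 0 := by
      apply Finset.le_inf'
      intro z hz
      have := hγle' z ((hmem z).1 hz)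
      simp only [zero_smul, sub_zero]
      linarith
    have hfT : f (γ / ‖u‖ ^ 2) ≤ 0 := by
      refine (Finset.inf'_le _ ((hmem z0).2 hz0)).trans ?_
      rw [← hu, inner_sub_right, inner_smul_right, real_inner_self_eq_norm_sq, ← hγ0]
      rw [div_mul_cancel₀ _ (by positivity)]
      simp
    obtain ⟨t, ⟨ht0, htT⟩, hft⟩ := intermediate_value_Icc' hT hf.continuousOn ⟨hfT, hf0⟩
    obtain ⟨z1, hz1, hz1e⟩ := Finset.exists_mem_eq_inf' hne
      (fun z => ⟪ψ z - ψ zstar, ξ - t • u⟫)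
    have hz1' : ⟪ψ z1 - ψ zstar, ξ - t • u⟫ = 0 := hz1e.symm.trans hft
    have hstar : ∀ z, ⟪ψ zstar, ξ - t • u⟫ ≤ ⟪ψ z, ξ - t • u⟫ := by
      intro z
      by_cases h : z = zstar
      · rw [h]
      · have h1 : f t ≤ ⟪ψ z - ψ zstar, ξ - t • u⟫ := Finset.inf'_le _ ((hmem z).2 h)
        rw [hft, inner_sub_left] at h1
        linarith
    have hF : ξ - t • u ∈ decisionFrontier ψ := by
      refine ⟨z1, zstar, (hmem z1).1 hz1, ?_, hstar⟩
      intro z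
      rw [inner_sub_left] at hz1'
      linarith [hstar z]
    unfold dF
    refine (Metric.infEDist_le_edist_of_mem hF).trans ?_
    rw [edist_dist, dist_eq_norm, sub_sub_cancel, norm_smul, Real.norm_of_nonneg ht0]
    apply ENNReal.ofReal_le_ofReal
    calc t * ‖u‖ ≤ γ / ‖u‖ ^ 2 * ‖u‖ := by gcongr
      _ = γ / ‖u‖ := by field_simp
      _ ≤ γ / m := by gcongr


end
end

section
/- Variance concentration for local averaging (first part of the nearest-neighbor concentration lemma): let x₁, …, x_n ∈ X, let Y₁, …, Y_n be independent with Y_i ∼ ρ|_{x_i}, and suppose the sub-exponential moment condition: for every i and every integer m ≥ 2, E‖φ(Y_i) − g*(x_i)‖^m ≤ (1/2) m! σ² M^{m−2}. Let α₁, …, α_n ≥ 0 with Σ_i α_i = 1 and α_i ≤ 1/k for all i (as holds for the k-nearest-neighbor weights). Then for every t > 0, P( ‖ Σ_{i=1}^n α_i (φ(Y_i) − g*(x_i)) ‖ > t ) ≤ 2 exp( − k t² / (2σ² + 2 M t) ). -/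
open MeasureTheory ProbabilityTheory Real
open scoped ENNReal

noncomputable section

lemma aux_pointwise_s9 {H : Type*} [NormedAddCommGroup H] [InnerProductSpace ℝ H] (a x : H) :
    cosh ‖a + x‖ ≤ cosh ‖a‖ + (sinh ‖a‖ / ‖a‖) * inner ℝ a x
      + cosh ‖a‖ * (exp ‖x‖ - 1 - ‖x‖) := by
  set r := ‖a‖ with hr
  set s := ‖x‖ with hs
  have hr0 : 0 ≤ r := norm_nonneg _
  have hs0 : 0 ≤ s := norm_nonneg _
  obtain ⟨c, hc1, hc2, hc⟩ : ∃ c : ℝ, -1 ≤ c ∧ c ≤ 1 ∧ inner ℝ a x = r * s * c := by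
    have h := abs_le.1 (abs_real_inner_le_norm a x)
    rcases eq_or_lt_of_le (mul_nonneg hr0 hs0) with h0 | h0
    · refine ⟨0, by norm_num, by norm_num, ?_⟩
      rw [← hr, ← hs, ← h0] at h
      linarith [h.1, h.2]
    · refine ⟨inner ℝ a x / (r * s), ?_, ?_, by rw [mul_div_cancel₀]; exact h0.ne'⟩
      · rw [le_div_iff₀ h0]; linarith [h.1]
      · rw [div_le_iff₀ h0]; linarith [h.2]
  have hsq : ‖a + x‖ ^ 2 = (1 + c) / 2 * (r + s) ^ 2 + (1 - c) / 2 * (r - s) ^ 2 := by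
    rw [norm_add_sq_real, hc, ← hr, ← hs]; ring
  have hconv : cosh ‖a + x‖ ≤ (1 + c) / 2 * cosh (r + s) + (1 - c) / 2 * cosh (r - s) := by
    refine hasSum_le (fun m => ?_) (Real.hasSum_cosh ‖a + x‖)
      (((Real.hasSum_cosh (r + s)).mul_left ((1 + c) / 2)).add
        ((Real.hasSum_cosh (r - s)).mul_left ((1 - c) / 2)))
    rw [← mul_div_assoc, ← mul_div_assoc, ← add_div]
    apply div_le_div_of_nonneg_right _ (by positivity)
    rw [pow_mul, pow_mul, pow_mul, hsq]
    have hcv : ConvexOn ℝ (Set.Ici 0) fun x : ℝ => x ^ m := convexOn_pow m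
    have := hcv.2 (Set.mem_Ici.2 (sq_nonneg (r + s))) (Set.mem_Ici.2 (sq_nonneg (r - s)))
      (by linarith : 0 ≤ (1 + c) / 2) (by linarith : 0 ≤ (1 - c) / 2) (by ring)
    simpa [smul_eq_mul] using this
  have hlin : (sinh r / r) * inner ℝ a x = sinh r * s * c := by
    rw [hc]
    rcases eq_or_lt_of_le hr0 with h0 | h0
    · simp [← h0]
    · field_simp
  have hsr : 0 ≤ sinh r := sinh_nonneg_iff.2 hr0
  have hss : 0 ≤ sinh s - s := sub_nonneg.2 (self_le_sinh_iff.2 hs0)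
  have hcs : sinh r ≤ cosh r := (sinh_lt_cosh r).le
  have hp : cosh (r + s) ≤ cosh r + sinh r * s + cosh r * (exp s - 1 - s) := by
    rw [cosh_add, ← cosh_add_sinh s]
    nlinarith [mul_le_mul_of_nonneg_right hcs hss]
  have hm : cosh (r - s) ≤ cosh r - sinh r * s + cosh r * (exp s - 1 - s) := by
    rw [cosh_sub, ← cosh_add_sinh s]
    nlinarith [mul_nonneg (add_nonneg hsr (cosh_pos r).le) hss]
  rw [hlin]
  nlinarith [mul_le_mul_of_nonneg_left hp (by linarith : 0 ≤ (1 + c) / 2),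
    mul_le_mul_of_nonneg_left hm (by linarith : 0 ≤ (1 - c) / 2)]

lemma aux_step {Y H : Type*} [MeasurableSpace Y]
    [NormedAddCommGroup H] [InnerProductSpace ℝ H] [CompleteSpace H]
    (μ : Measure Y) [IsProbabilityMeasure μ]
    (X : Y → H) (hX : Integrable X μ) (hX0 : ∫ y, X y ∂μ = 0)
    (D : ℝ) (hD0 : 0 ≤ D)
    (hD : ∫⁻ y, ENNReal.ofReal (exp ‖X y‖ - 1 - ‖X y‖) ∂μ ≤ ENNReal.ofReal D) (a : H) :
    ∫⁻ y, ENNReal.ofReal (cosh ‖a + X y‖) ∂μ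
      ≤ ENNReal.ofReal (cosh ‖a‖) * ENNReal.ofReal (1 + D) := by
  have hnn : ∀ y, 0 ≤ exp ‖X y‖ - 1 - ‖X y‖ := fun y => by
    linarith [add_one_le_exp ‖X y‖]
  have hmeas : AEStronglyMeasurable (fun y => exp ‖X y‖ - 1 - ‖X y‖) μ := by
    have h1 := hX.aestronglyMeasurable.norm
    exact ((continuous_exp.comp_aestronglyMeasurable h1).sub aestronglyMeasurable_const).sub h1
  have hint : Integrable (fun y => exp ‖X y‖ - 1 - ‖X y‖) μ := by
    refine ⟨hmeas, ?_⟩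
    rw [hasFiniteIntegral_iff_ofReal (Filter.Eventually.of_forall hnn)]
    exact hD.trans_lt ENNReal.ofReal_lt_top
  have hle : ∫ y, (exp ‖X y‖ - 1 - ‖X y‖) ∂μ ≤ D := by
    rw [integral_eq_lintegral_of_nonneg_ae (Filter.Eventually.of_forall hnn) hmeas]
    exact ENNReal.toReal_le_of_le_ofReal hD0 hD
  have hin : Integrable (fun y => inner ℝ a (X y)) μ := hX.const_inner a
  have hin0 : ∫ y, inner ℝ a (X y) ∂μ = 0 := by
    rw [integral_inner hX a, hX0, inner_zero_right]
  have hR : Integrable (fun y => cosh ‖a‖ + (sinh ‖a‖ / ‖a‖) * inner ℝ a (X y)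
      + cosh ‖a‖ * (exp ‖X y‖ - 1 - ‖X y‖)) μ :=
    ((integrable_const _).add (hin.const_mul _)).add (hint.const_mul _)
  calc ∫⁻ y, ENNReal.ofReal (cosh ‖a + X y‖) ∂μ
      ≤ ∫⁻ y, ENNReal.ofReal (cosh ‖a‖ + (sinh ‖a‖ / ‖a‖) * inner ℝ a (X y)
      + cosh ‖a‖ * (exp ‖X y‖ - 1 - ‖X y‖)) ∂μ :=
        lintegral_mono fun y => ENNReal.ofReal_le_ofReal (aux_pointwise_s9 a (X y))
    _ = ENNReal.ofReal (∫ y, (cosh ‖a‖ + (sinh ‖a‖ / ‖a‖) * inner ℝ a (X y)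
      + cosh ‖a‖ * (exp ‖X y‖ - 1 - ‖X y‖)) ∂μ) := by
        rw [ofReal_integral_eq_lintegral_ofReal hR]
        exact Filter.Eventually.of_forall fun y =>
          (cosh_pos _).le.trans (aux_pointwise_s9 a (X y))
    _ ≤ ENNReal.ofReal (cosh ‖a‖ * (1 + D)) := by
        apply ENNReal.ofReal_le_ofReal
        have hA : Integrable (fun y => cosh ‖a‖ + (sinh ‖a‖ / ‖a‖) * inner ℝ a (X y)) μ :=
          (integrable_const _).add (hin.const_mul _)
        rw [integral_add hA (hint.const_mul _),
          integral_add (integrable_const _) (hin.const_mul _), integral_const_mul,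
          integral_const_mul, hin0]
        simp only [integral_const, probReal_univ, smul_eq_mul, one_mul, mul_zero, add_zero]
        nlinarith [mul_le_mul_of_nonneg_left hle (cosh_pos ‖a‖).le]
    _ = _ := ENNReal.ofReal_mul (cosh_pos _).le

lemma aux_prod {Y H : Type*} [MeasurableSpace Y]
    [NormedAddCommGroup H] [InnerProductSpace ℝ H] [CompleteSpace H]
    [SecondCountableTopology H] [MeasurableSpace H] [BorelSpace H]
    (n : ℕ) : ∀ (μ : Fin n → Measure Y) [∀ i, IsProbabilityMeasure (μ i)]
    (X : Fin n → Y → H) (_ : ∀ i, Measurable (X i)) (_ : ∀ i, Integrable (X i) (μ i))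
    (_ : ∀ i, ∫ y, X i y ∂(μ i) = 0)
    (D : Fin n → ℝ) (_ : ∀ i, 0 ≤ D i)
    (_ : ∀ i, ∫⁻ y, ENNReal.ofReal (exp ‖X i y‖ - 1 - ‖X i y‖) ∂(μ i) ≤ ENNReal.ofReal (D i))
    (a : H),
    ∫⁻ ω, ENNReal.ofReal (cosh ‖a + ∑ i, X i (ω i)‖) ∂(Measure.pi μ)
      ≤ ENNReal.ofReal (cosh ‖a‖) * ∏ i, ENNReal.ofReal (1 + D i) := by
  induction n with
  | zero => intro μ _ X _ _ _ D _ _ a; simp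
  | succ n ih =>
    intro μ _ X hXm hX hX0 D hD0 hD a
    have hmp := (measurePreserving_piFinSuccAbove μ 0).symm
    have hmF : Measurable fun ω : Fin (n + 1) → Y =>
        ENNReal.ofReal (cosh ‖a + ∑ i, X i (ω i)‖) := by
      apply ENNReal.measurable_ofReal.comp
      apply continuous_cosh.measurable.comp
      apply Measurable.norm
      apply Measurable.const_add
      exact Finset.measurable_sum _ fun i _ => (hXm i).comp (measurable_pi_apply i)
    rw [← hmp.lintegral_comp hmF, lintegral_prod]
    swap
    · exact (hmF.comp hmp.measurable).aemeasurable
    calc _ = ∫⁻ y, ∫⁻ ω, ENNReal.ofReal (cosh ‖(a + X 0 y) + ∑ i, X (Fin.succ i) (ω i)‖)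
              ∂(Measure.pi fun i : Fin n => μ i.succ) ∂(μ 0) := by
          simp [Fin.sum_univ_succ, add_assoc, MeasurableEquiv.piFinSuccAbove,
            Fin.insertNthEquiv, Fin.insertNth_zero]
      _ ≤ ∫⁻ y, ENNReal.ofReal (cosh ‖a + X 0 y‖) * ∏ i : Fin n, ENNReal.ofReal (1 + D i.succ)
              ∂(μ 0) := by
          refine lintegral_mono fun y => ?_
          exact ih (fun i => μ i.succ) (fun i => X i.succ) (fun i => hXm _) (fun i => hX _)
            (fun i => hX0 _) (fun i => D i.succ) (fun i => hD0 _) (fun i => hD _) _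
      _ = (∫⁻ y, ENNReal.ofReal (cosh ‖a + X 0 y‖) ∂(μ 0)) *
            ∏ i : Fin n, ENNReal.ofReal (1 + D i.succ) := by
          rw [lintegral_mul_const]
          apply ENNReal.measurable_ofReal.comp
          apply continuous_cosh.measurable.comp
          exact ((hXm 0).const_add a).norm
      _ ≤ _ := by
          rw [Fin.prod_univ_succ, ← mul_assoc]
          gcongr
          exact aux_step (μ 0) (X 0) (hX 0) (hX0 0) (D 0) (hD0 0) (hD 0) a

lemma aux_moment {Y H : Type*} [MeasurableSpace Y]
    [NormedAddCommGroup H] [InnerProductSpace ℝ H]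
    [MeasurableSpace H] [BorelSpace H]
    (μ : Measure Y) (Z : Y → H) (hZ : Measurable Z)
    (σ2 M : ℝ) (hσ2 : 0 < σ2) (hM : 0 < M)
    (hm : ∀ m : ℕ, 2 ≤ m → ∫⁻ y, (‖Z y‖₊ : ℝ≥0∞) ^ m ∂μ
        ≤ ENNReal.ofReal ((1 / 2) * m.factorial * σ2 * M ^ (m - 2)))
    (b : ℝ) (hb : 0 ≤ b) (hbM : b * M < 1) :
    ∫⁻ y, ENNReal.ofReal (exp ‖b • Z y‖ - 1 - ‖b • Z y‖) ∂μ
      ≤ ENNReal.ofReal (b ^ 2 * σ2 / 2 / (1 - b * M)) := by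
  have hexp : ∀ s : ℝ, HasSum (fun m : ℕ => s ^ (m + 2) / (m + 2).factorial)
      (exp s - 1 - s) := by
    intro s
    have h := NormedSpace.expSeries_div_hasSum_exp (𝔸 := ℝ) s
    rw [← Real.exp_eq_exp_ℝ] at h
    have := (hasSum_nat_add_iff' (f := fun m : ℕ => s ^ m / (m.factorial : ℝ)) 2).2 h
    simpa [Finset.sum_range_succ, sub_sub] using this
  have hgeo : HasSum (fun m : ℕ => b ^ 2 * σ2 / 2 * (b * M) ^ m)
      (b ^ 2 * σ2 / 2 / (1 - b * M)) := by
    rw [div_eq_mul_inv _ (1 - b * M)]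
    exact (hasSum_geometric_of_lt_one (by positivity) hbM).mul_left _
  have key : ∀ y, ENNReal.ofReal (exp ‖b • Z y‖ - 1 - ‖b • Z y‖)
      = ∑' m : ℕ, ENNReal.ofReal (b ^ (m + 2) / (m + 2).factorial) * (‖Z y‖₊ : ℝ≥0∞) ^ (m + 2) := by
    intro y
    rw [← (hexp ‖b • Z y‖).tsum_eq, ENNReal.ofReal_tsum_of_nonneg (fun m => by positivity)
      (hexp _).summable]
    congr 1; ext1 m
    rw [norm_smul, Real.norm_of_nonneg hb, mul_pow, mul_div_right_comm,
      ENNReal.ofReal_mul (by positivity), ENNReal.ofReal_pow (norm_nonneg _), ofReal_norm]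
    rfl
  simp_rw [key]
  rw [lintegral_tsum, ← hgeo.tsum_eq, ENNReal.ofReal_tsum_of_nonneg (fun m => by positivity)
      hgeo.summable]
  · refine ENNReal.tsum_le_tsum fun m => ?_
    rw [lintegral_const_mul' _ _ ENNReal.ofReal_ne_top]
    refine (mul_le_mul_right (hm (m + 2) (by omega)) _).trans ?_
    rw [← ENNReal.ofReal_mul (by positivity)]
    apply ENNReal.ofReal_le_ofReal
    have : ((m + 2).factorial : ℝ) ≠ 0 := by positivity
    apply le_of_eq
    simp only [Nat.add_sub_cancel]
    field_simp
    ring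
  · intro m
    have : Measurable fun y => (‖Z y‖₊ : ℝ≥0∞) := hZ.nnnorm.coe_nnreal_ennreal
    exact ((this.pow_const _).const_mul _).aemeasurable

/-- **Variance concentration for local averaging** (Bernstein inequality in Hilbert space
applied to weighted sums with weights bounded by `1/k`, as for `k`-nearest-neighbor weights):
if `Y₁, …, Yₙ` are independent with `Yᵢ ∼ ρ|_{xᵢ}` (here `ν i = ρ|_{xᵢ}`, encoded by the
product measure), and the conditional distributions satisfy a sub-exponential moment
condition, then the weighted deviation from the conditional means concentrates. -/
theorem variance_concentration_local_averaging
    {𝒴 H : Type*} [MeasurableSpace 𝒴]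
    [NormedAddCommGroup H] [InnerProductSpace ℝ H] [CompleteSpace H]
    [SecondCountableTopology H] [MeasurableSpace H] [BorelSpace H]
    (n k : ℕ) (hk : 0 < k)
    (φ : 𝒴 → H) (hφ : Measurable φ)
    (ν : Fin n → Measure 𝒴) [∀ i, IsProbabilityMeasure (ν i)]
    (σ2 M : ℝ) (hσ2 : 0 < σ2) (hM : 0 < M)
    (hmoment : ∀ i, ∀ m : ℕ, 2 ≤ m →
      ∫⁻ y, (‖φ y - ∫ y', φ y' ∂(ν i)‖₊ : ℝ≥0∞) ^ m ∂(ν i)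
        ≤ ENNReal.ofReal ((1 / 2) * m.factorial * σ2 * M ^ (m - 2)))
    (α : Fin n → ℝ) (hα0 : ∀ i, 0 ≤ α i) (hα1 : ∑ i, α i = 1)
    (hαk : ∀ i, α i ≤ 1 / k)
    (t : ℝ) (ht : 0 < t) :
    Measure.pi ν {ω | t < ‖∑ i, α i • (φ (ω i) - ∫ y, φ y ∂(ν i))‖}
      ≤ ENNReal.ofReal (2 * exp (-(k * t ^ 2) / (2 * σ2 + 2 * M * t))) := by
  classical
  set c : Fin n → H := fun i => ∫ y, φ y ∂(ν i) with hc
  have hZm : ∀ i, Measurable fun y => φ y - c i := fun i => hφ.sub_const _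
  have hZi : ∀ i, Integrable (fun y => φ y - c i) (ν i) := by
    intro i
    have h2 : MemLp (fun y => φ y - c i) 2 (ν i) := by
      refine ⟨(hZm i).aestronglyMeasurable, ?_⟩
      rw [eLpNorm_lt_top_iff_lintegral_rpow_enorm_lt_top (by norm_num) (by norm_num)]
      refine lt_of_le_of_lt (le_of_eq ?_) ((hmoment i 2 le_rfl).trans_lt ENNReal.ofReal_lt_top)
      refine lintegral_congr fun y => ?_
      simp [enorm, hc]
    exact h2.integrable (by norm_num)
  have hZ0 : ∀ i, ∫ y, (φ y - c i) ∂(ν i) = 0 := by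
    intro i
    have hφi : Integrable φ (ν i) := by
      have h := (hZi i).add (integrable_const (c i))
      refine h.congr (Filter.Eventually.of_forall fun y => ?_)
      simp
    rw [integral_sub hφi (integrable_const _)]
    simp [hc]
  have hkR : (0 : ℝ) < k := by exact_mod_cast hk
  have hden : 0 < σ2 + M * t := by positivity
  set β : ℝ := t / (σ2 + M * t) with hβ
  have hβ0 : 0 < β := by positivity
  have hβM : 1 - β * M = σ2 / (σ2 + M * t) := by rw [hβ]; field_simp; ring
  have hβM0 : 0 < 1 - β * M := by rw [hβM]; positivity
  set l : ℝ := k * β with hl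
  have hl0 : 0 < l := by positivity
  set b : Fin n → ℝ := fun i => l * α i with hbdef
  have hb0 : ∀ i, 0 ≤ b i := fun i => mul_nonneg hl0.le (hα0 i)
  have hbβ : ∀ i, b i ≤ β := by
    intro i
    have := mul_le_mul_of_nonneg_left (hαk i) hl0.le
    have h2 : l * (1 / k) = β := by rw [hl]; field_simp
    simpa [hbdef, h2] using this.trans_eq h2
  have hbM : ∀ i, b i * M ≤ β * M := fun i => mul_le_mul_of_nonneg_right (hbβ i) hM.le
  set D : Fin n → ℝ := fun i => b i ^ 2 * σ2 / 2 / (1 - b i * M) with hDdef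
  have hD0 : ∀ i, 0 ≤ D i := fun i => by
    have : 0 ≤ 1 - b i * M := by linarith [hbM i]
    have := hb0 i
    simp only [hDdef]; positivity
  have hmain := aux_prod n ν (fun i y => b i • (φ y - c i)) (fun i => (hZm i).const_smul _)
    (fun i => (hZi i).smul _)
    (fun i => by rw [integral_smul, hZ0, smul_zero]) D hD0
    (fun i => aux_moment (ν i) _ (hZm i) σ2 M hσ2 hM (hmoment i) (b i) (hb0 i)
      (by linarith [hbM i])) 0
  have hDsum : ∑ i, D i ≤ l * β * σ2 / 2 / (1 - β * M) := by
    have : ∀ i, D i ≤ α i * (l * β * σ2 / 2 / (1 - β * M)) := by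
      intro i
      have e : α i * (l * β * σ2 / 2 / (1 - β * M)) = b i * β * σ2 / 2 / (1 - β * M) := by
        simp only [hbdef]; ring
      rw [e]
      apply div_le_div₀
      · have := hb0 i; positivity
      · nlinarith [mul_le_mul_of_nonneg_left (hbβ i) (mul_nonneg (hb0 i) hσ2.le)]
      · exact hβM0
      · linarith [hbM i]
    refine (Finset.sum_le_sum fun i _ => this i).trans ?_
    rw [← Finset.sum_mul, hα1, one_mul]
  have hprod : ∏ i, ENNReal.ofReal (1 + D i) ≤ ENNReal.ofReal (exp (l * β * σ2 / 2 / (1 - β * M))) := by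
    rw [← ENNReal.ofReal_prod_of_nonneg (fun i _ => by linarith [hD0 i])]
    apply ENNReal.ofReal_le_ofReal
    calc ∏ i, (1 + D i) ≤ ∏ i, exp (D i) :=
          Finset.prod_le_prod (fun i _ => by linarith [hD0 i])
            fun i _ => by linarith [add_one_le_exp (D i)]
      _ = exp (∑ i, D i) := (exp_sum _ _).symm
      _ ≤ _ := exp_le_exp.2 hDsum
  have hbound : ∫⁻ ω, ENNReal.ofReal (cosh ‖0 + ∑ i, b i • (φ (ω i) - c i)‖) ∂(Measure.pi ν)
      ≤ ENNReal.ofReal (exp (l * β * σ2 / 2 / (1 - β * M))) := by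
    refine hmain.trans ?_
    simpa using hprod
  have hsub : {ω : Fin n → 𝒴 | t < ‖∑ i, α i • (φ (ω i) - c i)‖} ⊆
      {ω | ENNReal.ofReal (exp (l * t) / 2) ≤
        ENNReal.ofReal (cosh ‖0 + ∑ i, b i • (φ (ω i) - c i)‖)} := by
    intro ω hω
    simp only [Set.mem_setOf_eq] at hω ⊢
    apply ENNReal.ofReal_le_ofReal
    have e : ∑ i, b i • (φ (ω i) - c i) = l • ∑ i, α i • (φ (ω i) - c i) := by
      simp [hbdef, Finset.smul_sum, mul_smul]
    rw [zero_add, e, norm_smul, Real.norm_of_nonneg hl0.le, cosh_eq]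
    have h1 := exp_le_exp.2 (mul_le_mul_of_nonneg_left hω.le hl0.le)
    have h2 := (exp_pos (-(l * ‖∑ i, α i • (φ (ω i) - c i)‖))).le
    linarith
  have hmF : Measurable fun ω : Fin n → 𝒴 =>
      ENNReal.ofReal (cosh ‖0 + ∑ i, b i • (φ (ω i) - c i)‖) := by
    apply ENNReal.measurable_ofReal.comp
    apply continuous_cosh.measurable.comp
    apply Measurable.norm
    apply Measurable.const_add
    exact Finset.measurable_sum _ fun i _ =>
      ((hZm i).comp (measurable_pi_apply i)).const_smul (b i)
  refine (measure_mono hsub).trans ?_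
  have hpos : 0 < exp (l * t) / 2 := by positivity
  refine (meas_ge_le_lintegral_div hmF.aemeasurable (by simpa using hpos)
    ENNReal.ofReal_ne_top).trans ?_
  refine (ENNReal.div_le_div_right hbound _).trans ?_
  rw [← ENNReal.ofReal_div_of_pos hpos]
  apply ENNReal.ofReal_le_ofReal
  apply le_of_eq
  have e : -(k * t ^ 2) / (2 * σ2 + 2 * M * t) = l * β * σ2 / 2 / (1 - β * M) - l * t := by
    rw [hβM, hl, hβ]
    field_simp
    ring
  rw [e, exp_sub]
  field_simp

end
end

section
/- Bound on the effective dimension: let (λ_i)_{i∈ℕ} be nonnegative reals with λ_i ≤ a₁ (i+1)^{−1/σ} for all i, where σ ∈ (0,1) and a₁ > 0. Then for every λ > 0, Σ_{i∈ℕ} λ_i / (λ_i + λ) ≤ a₂ λ^{−σ}, where a₂ = ∫_0^∞ a₁ / (a₁ + t^{1/σ}) dt < ∞. -/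
open MeasureTheory
open scoped ENNReal

/-- **Bound on the effective dimension**: if the eigenvalues satisfy
`λᵢ ≤ a₁ (i+1)^{−1/σ}` with `σ ∈ (0,1)`, then the effective dimension
`N(λ) = Σᵢ λᵢ/(λᵢ+λ)` is bounded by `a₂ λ^{−σ}`, where
`a₂ = ∫₀^∞ a₁/(a₁ + t^{1/σ}) dt` is finite. -/
theorem effective_dimension_bound
    (lam : ℕ → ℝ) (hnonneg : ∀ i, 0 ≤ lam i)
    (σ a₁ : ℝ) (hσ : σ ∈ Set.Ioo (0 : ℝ) 1) (ha₁ : 0 < a₁)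
    (hbound : ∀ i : ℕ, lam i ≤ a₁ * ((i : ℝ) + 1) ^ (-(1 / σ))) :
    IntegrableOn (fun t : ℝ => a₁ / (a₁ + t ^ (1 / σ))) (Set.Ioi 0) ∧
    ∀ l : ℝ, 0 < l →
      ∑' i : ℕ, ENNReal.ofReal (lam i / (lam i + l))
        ≤ ENNReal.ofReal ((∫ t in Set.Ioi (0 : ℝ), a₁ / (a₁ + t ^ (1 / σ))) * l ^ (-σ)) := by
  obtain ⟨hσ0, hσ1⟩ := hσ
  have hp : 1 < 1 / σ := by rw [lt_div_iff₀ hσ0]; linarith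
  have hp0 : 0 ≤ 1 / σ := by linarith
  have hpσ : σ * (1 / σ) = 1 := by field_simp
  generalize hpd : 1 / σ = p at *
  set g : ℝ → ℝ := fun t => a₁ / (a₁ + t ^ p) with hg
  have hanti : AntitoneOn g (Set.Ici 0) := by
    intro x hx y hy hxy
    have hx' : (0:ℝ) ≤ x := hx
    have h1 : 0 ≤ x ^ p := Real.rpow_nonneg hx' p
    have h2 : x ^ p ≤ y ^ p := Real.rpow_le_rpow hx' hxy hp0
    simp only [hg]
    gcongr
  have hnn : ∀ t : ℝ, 0 ≤ t → 0 ≤ g t := by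
    intro t ht
    have h1 : 0 ≤ t ^ p := Real.rpow_nonneg ht p
    simp only [hg]
    positivity
  have hint : IntegrableOn g (Set.Ioi 0) := by
    rw [← Set.Ioc_union_Ioi_eq_Ioi (zero_le_one : (0:ℝ) ≤ 1)]
    refine IntegrableOn.union ?_ ?_
    · have : IntervalIntegrable g volume 0 1 := by
        apply AntitoneOn.intervalIntegrable
        apply hanti.mono
        rw [Set.uIcc_of_le zero_le_one]
        exact Set.Icc_subset_Ici_self
      rwa [intervalIntegrable_iff_integrableOn_Ioc_of_le zero_le_one] at this
    · have h1 : IntegrableOn (fun t : ℝ => a₁ * t ^ (-p)) (Set.Ioi 1) :=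
        (integrableOn_Ioi_rpow_of_lt (by linarith) one_pos).const_mul a₁
      refine Integrable.mono' h1 ?_ ?_
      · apply Measurable.aestronglyMeasurable
        simp only [hg]
        fun_prop
      · filter_upwards [ae_restrict_mem measurableSet_Ioi] with t ht
        have ht0 : (0:ℝ) < t := lt_trans one_pos ht
        have h2 : 0 < t ^ p := Real.rpow_pos_of_pos ht0 p
        rw [Real.norm_of_nonneg (hnn t ht0.le), Real.rpow_neg ht0.le, ← div_eq_mul_inv]
        simp only [hg]
        gcongr
        linarith
  refine ⟨hint, fun l hl => ?_⟩
  have hb : 0 < l ^ σ := Real.rpow_pos_of_pos hl σ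
  have hint2 : IntegrableOn (fun x => g (l ^ σ * x)) (Set.Ioi 0) := by
    rw [integrableOn_Ioi_comp_mul_left_iff g 0 hb, mul_zero]
    exact hint
  have hval : ∫ x in Set.Ioi (0:ℝ), g (l ^ σ * x) = (∫ t in Set.Ioi (0:ℝ), g t) * l ^ (-σ) := by
    rw [integral_comp_mul_left_Ioi g 0 hb, mul_zero, smul_eq_mul, Real.rpow_neg hl.le, mul_comm]
  have hanti2 : AntitoneOn (fun x => g (l ^ σ * x)) (Set.Ici 0) := by
    intro x hx y hy hxy
    exact hanti (mul_nonneg hb.le hx) (mul_nonneg hb.le hy) (mul_le_mul_of_nonneg_left hxy hb.le)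
  have hterm : ∀ i : ℕ, lam i / (lam i + l) ≤ g (l ^ σ * ((i + 1 : ℕ) : ℝ)) := by
    intro i
    have hi : (0:ℝ) < (i:ℝ) + 1 := by positivity
    have hq : 0 < ((i:ℝ) + 1) ^ p := Real.rpow_pos_of_pos hi p
    have hbi := hbound i
    rw [Real.rpow_neg hi.le, ← div_eq_mul_inv, le_div_iff₀ hq] at hbi
    have hni := hnonneg i
    simp only [hg]
    push_cast
    rw [Real.mul_rpow hb.le hi.le, ← Real.rpow_mul hl.le, hpσ, Real.rpow_one,
      div_le_div_iff₀ (by positivity) (by positivity)]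
    nlinarith [mul_le_mul_of_nonneg_left hbi hl.le]
  rw [← hval]
  refine ENNReal.tsum_le_of_sum_range_le fun n => ?_
  rw [← ENNReal.ofReal_sum_of_nonneg
    (fun i _ => div_nonneg (hnonneg i) (add_nonneg (hnonneg i) hl.le))]
  apply ENNReal.ofReal_le_ofReal
  refine (Finset.sum_le_sum fun i _ => hterm i).trans ?_
  exact AntitoneOn.sum_range_le_integral (f := fun x => g (l ^ σ * x))
    (hanti2.mono Set.Icc_subset_Ici_self) hint2 (fun t ht => hnn _ (mul_nonneg hb.le (le_of_lt ht)))
end
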